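/- arXiv:2307.14507 — 2 statements merged into one kernel-verified Lean document; each statement's English description precedes it below -/
import Mathlib

section
/- For every integer k ≥ 1 and every p ∈ [0,1), the matrix I − T is invertible and its inverse has entries ((I−T)^{-1})_{i,j} = (1−p)^{-1} · (2^k−1)/(2^k−2^{j−1}) whenever 1 ≤ i ≤ j ≤ k, and ((I−T)^{-1})_{i,j} = 0 whenever 1 ≤ j < i ≤ k. -/
open Finset Matrix

/-- The sub-stochastic matrix `T` of the rank Markov chain: rows/columns indexed by
`Fin k` (index `i : Fin k` corresponds to the 1-indexed row `i+1`). -/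
noncomputable def Tmat (k : ℕ) (p : ℝ) : Matrix (Fin k) (Fin k) ℝ := fun i j =>
  if i = j then p + (1 - p) * ((2 : ℝ) ^ (i : ℕ) - 1) / (2 ^ k - 1)
  else if (j : ℕ) = (i : ℕ) + 1 then (1 - p) * ((2 : ℝ) ^ k - 2 ^ (i : ℕ)) / (2 ^ k - 1)
  else 0

/-- `I - T` has diagonal entries `d i` and superdiagonal entries `-d i`. -/
theorem one_sub_Tmat_apply {k : ℕ} (hk : 1 ≤ k) (p : ℝ) (i l : Fin k) :
    (1 - Tmat k p) i l = (1 - p) * ((2 : ℝ) ^ k - 2 ^ (i : ℕ)) / (2 ^ k - 1) *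
      ((if (l : ℕ) = i then 1 else 0) - (if (l : ℕ) = i + 1 then 1 else 0)) := by
  have h : (2 : ℝ) ^ k - 1 ≠ 0 := (sub_pos.2 (one_lt_pow₀ one_lt_two (by omega))).ne'
  simp only [Matrix.sub_apply, Matrix.one_apply, Tmat, Fin.ext_iff, eq_comm (a := (i : ℕ))]
  by_cases h1 : (l : ℕ) = i
  · simp only [h1, if_true, Nat.left_eq_add, one_ne_zero, if_false]
    field_simp
    ring
  · by_cases h2 : (l : ℕ) = i + 1 <;> simp [h1, h2]

/-- The claimed inverse of `I - T`. -/
noncomputable def fundamentalMat (k : ℕ) (p : ℝ) : Matrix (Fin k) (Fin k) ℝ := fun i j =>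
  if (i : ℕ) ≤ (j : ℕ) then
    (1 - p)⁻¹ * (((2 : ℝ) ^ k - 1) / ((2 : ℝ) ^ k - 2 ^ (j : ℕ)))
  else 0

theorem one_sub_Tmat_mul_fundamentalMat {k : ℕ} (hk : 1 ≤ k) {p : ℝ} (hp : p < 1) :
    (1 - Tmat k p) * fundamentalMat k p = 1 := by
  ext i j
  have h : (2 : ℝ) ^ k - 1 ≠ 0 := (sub_pos.2 (one_lt_pow₀ one_lt_two (by omega))).ne'
  have hq : 1 - p ≠ 0 := (sub_pos.2 hp).ne'
  have hj : (2 : ℝ) ^ k - 2 ^ (j : ℕ) ≠ 0 :=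
    (sub_pos.2 (pow_lt_pow_right₀ one_lt_two j.isLt)).ne'
  simp only [Matrix.mul_apply, one_sub_Tmat_apply hk, fundamentalMat, Matrix.one_apply,
    Fin.ext_iff]
  rw [Fin.sum_univ_eq_sum_range (fun l : ℕ =>
    (1 - p) * ((2 : ℝ) ^ k - 2 ^ (i : ℕ)) / (2 ^ k - 1) *
      ((if l = i then 1 else 0) - (if l = i + 1 then 1 else 0)) *
      (if l ≤ (j : ℕ) then (1 - p)⁻¹ * (((2 : ℝ) ^ k - 1) / ((2 : ℝ) ^ k - 2 ^ (j : ℕ)))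
        else 0)) k]
  simp only [mul_assoc, ← Finset.mul_sum, sub_mul, Finset.sum_sub_distrib, ite_mul, one_mul,
    zero_mul, Finset.sum_ite_eq', Finset.mem_range, i.isLt, if_true]
  have hjk := j.isLt
  rcases lt_trichotomy (i : ℕ) j with hij | hij | hij
  · simp [hij.le, hij.ne, Nat.succ_le_of_lt hij, (Nat.succ_le_of_lt hij).trans_lt hjk]
  · simp only [hij, le_refl, if_true, Nat.not_succ_le_self, if_false, ite_self, sub_zero]
    field_simp
  · simp [hij.not_ge, hij.ne', show ¬ (i : ℕ) + 1 ≤ j by omega]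

theorem stmt7 (k : ℕ) (hk : 1 ≤ k) (p : ℝ) (hp : p ∈ Set.Ico (0 : ℝ) 1) :
    IsUnit ((1 : Matrix (Fin k) (Fin k) ℝ) - Tmat k p) ∧
    ∀ i j : Fin k,
      ((1 - Tmat k p)⁻¹) i j =
        if (i : ℕ) ≤ (j : ℕ) then
          (1 - p)⁻¹ * (((2 : ℝ) ^ k - 1) / ((2 : ℝ) ^ k - 2 ^ (j : ℕ)))
        else 0 := by
  have h := one_sub_Tmat_mul_fundamentalMat hk hp.2
  refine ⟨IsUnit.of_mul_eq_one _ h, fun i j => ?_⟩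
  rw [Matrix.inv_eq_right_inv h]
  rfl
end

section
/- For every integer k ≥ 1 and every p ∈ [0,1], letting P be the (k+1)×(k+1) real matrix with rows and columns indexed 0,…,k, entries P_{r,r} = p + (1−p)(2^r−1)/(2^k−1) for 0 ≤ r ≤ k−1, P_{r,r+1} = (1−p)(2^k−2^r)/(2^k−1) for 0 ≤ r ≤ k−1, P_{k,k} = 1, and all other entries 0, the inequality Σ_{r=0}^{k} r · (e_0ᵀ P^k)_r ≤ k(1−p) holds; that is, the expected rank after k steps of the random linear fountain coding Markov chain started at rank 0 is at most k(1−p), the expected rank after k systematic transmissions. -/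
open Finset Matrix

/-- The one-step transfer matrix of the rank Markov chain of the random linear fountain
code, rows/columns indexed `0, …, k` by `Fin (k+1)`. -/
noncomputable def Pmat (k : ℕ) (p : ℝ) : Matrix (Fin (k + 1)) (Fin (k + 1)) ℝ :=
  fun r s =>
    if (r : ℕ) = k ∧ (s : ℕ) = k then 1
    else if r = s then p + (1 - p) * ((2 : ℝ) ^ (r : ℕ) - 1) / (2 ^ k - 1)
    else if (s : ℕ) = (r : ℕ) + 1 then (1 - p) * ((2 : ℝ) ^ k - 2 ^ (r : ℕ)) / (2 ^ k - 1)
    else 0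

lemma two_pow_sub_one_pos {k : ℕ} (hk : 1 ≤ k) : (0 : ℝ) < 2 ^ k - 1 :=
  sub_pos.2 (one_lt_pow₀ one_lt_two (by omega))

lemma Pmat_nonneg {k : ℕ} (hk : 1 ≤ k) {p : ℝ} (hp : p ∈ Set.Icc (0 : ℝ) 1)
    (r s : Fin (k + 1)) : 0 ≤ Pmat k p r s := by
  have hD := two_pow_sub_one_pos hk
  have h1 : (1 : ℝ) ≤ 2 ^ (r : ℕ) := one_le_pow₀ one_le_two
  have h2 : (2 : ℝ) ^ (r : ℕ) ≤ 2 ^ k := pow_le_pow_right₀ one_le_two (by omega)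
  have hp0 := hp.1
  have hp1 := sub_nonneg.2 hp.2
  unfold Pmat
  split_ifs
  · exact zero_le_one
  · exact add_nonneg hp0 (div_nonneg (mul_nonneg hp1 (sub_nonneg.2 h1)) hD.le)
  · exact div_nonneg (mul_nonneg hp1 (sub_nonneg.2 h2)) hD.le
  · exact le_rfl

lemma sum_Pmat_last (k : ℕ) (p : ℝ) (g : ℕ → ℝ) :
    ∑ s : Fin (k + 1), Pmat k p (Fin.last k) s * g s = g k := by
  rw [Finset.sum_eq_single (Fin.last k)]
  · simp [Pmat]
  · intro s _ hs
    have h1 : (s : ℕ) ≠ k := fun h => hs (Fin.ext h)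
    have h2 : (s : ℕ) ≠ k + 1 := by omega
    simp [Pmat, h1, h2, hs.symm]
  · simp

lemma sum_Pmat_castSucc (k : ℕ) (p : ℝ) (g : ℕ → ℝ) (i : Fin k) :
    ∑ s : Fin (k + 1), Pmat k p i.castSucc s * g s =
      (p + (1 - p) * ((2 : ℝ) ^ (i : ℕ) - 1) / (2 ^ k - 1)) * g i +
        (1 - p) * ((2 : ℝ) ^ k - 2 ^ (i : ℕ)) / (2 ^ k - 1) * g (i + 1) := by
  have hi : (i : ℕ) ≠ k := i.isLt.ne
  have hne : i.castSucc ≠ i.succ := i.castSucc_lt_succ.ne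
  rw [Finset.sum_eq_add_of_mem i.castSucc i.succ (mem_univ _) (mem_univ _) hne]
  · simp [Pmat, hi, hne]
  · rintro s - ⟨h1, h2⟩
    have h3 : (s : ℕ) ≠ i + 1 := fun h => h2 (Fin.ext h)
    simp [Pmat, hi, h1.symm, h3]

/-- One step of the chain raises the expected rank by at most `1 - p`. -/
lemma sum_Pmat_mul_rank_add_le {k : ℕ} (hk : 1 ≤ k) {p : ℝ} (hp : p ≤ 1) (c : ℝ)
    (r : Fin (k + 1)) :
    ∑ s : Fin (k + 1), Pmat k p r s * (((s : ℕ) : ℝ) + c) ≤ ((r : ℕ) : ℝ) + c + (1 - p) := by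
  have hD := two_pow_sub_one_pos hk
  induction r using Fin.lastCases with
  | last =>
    rw [sum_Pmat_last k p (fun s => (s : ℝ) + c), Fin.val_last]
    linarith
  | cast i =>
    rw [sum_Pmat_castSucc k p (fun s => (s : ℝ) + c)]
    have h1 : (1 : ℝ) ≤ 2 ^ (i : ℕ) := one_le_pow₀ one_le_two
    have hb : (1 - p) * ((2 : ℝ) ^ k - 2 ^ (i : ℕ)) / (2 ^ k - 1) ≤ 1 - p := by
      rw [div_le_iff₀ hD]
      exact mul_le_mul_of_nonneg_left (by linarith) (sub_nonneg.2 hp)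
    have hab : p + (1 - p) * ((2 : ℝ) ^ (i : ℕ) - 1) / (2 ^ k - 1) =
        1 - (1 - p) * ((2 : ℝ) ^ k - 2 ^ (i : ℕ)) / (2 ^ k - 1) := by
      field_simp
      ring
    rw [hab]
    push_cast [Fin.val_castSucc]
    linarith

lemma Pmat_pow_mulVec_rank_le {k : ℕ} (hk : 1 ≤ k) {p : ℝ} (hp : p ∈ Set.Icc (0 : ℝ) 1)
    (n : ℕ) (r : Fin (k + 1)) :
    ((Pmat k p ^ n) *ᵥ fun s : Fin (k + 1) => ((s : ℕ) : ℝ)) r ≤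
      ((r : ℕ) : ℝ) + n * (1 - p) := by
  induction n generalizing r with
  | zero => simp
  | succ n ih =>
    rw [pow_succ', ← Matrix.mulVec_mulVec]
    calc _ ≤ ∑ s : Fin (k + 1), Pmat k p r s * (((s : ℕ) : ℝ) + n * (1 - p)) :=
          Finset.sum_le_sum fun s _ => mul_le_mul_of_nonneg_left (ih s) (Pmat_nonneg hk hp r s)
      _ ≤ ((r : ℕ) : ℝ) + n * (1 - p) + (1 - p) := sum_Pmat_mul_rank_add_le hk hp.2 _ r
      _ = _ := by push_cast; ring

/-- The expected rank after `k` steps of the RLFC Markov chain started at rank `0`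
is at most `k(1−p)`, the expected rank after `k` systematic transmissions. -/
theorem stmt16 (k : ℕ) (hk : 1 ≤ k) (p : ℝ) (hp : p ∈ Set.Icc (0 : ℝ) 1) :
    ∑ r : Fin (k + 1),
        ((r : ℕ) : ℝ) * Matrix.vecMul (Pi.single (0 : Fin (k + 1)) (1 : ℝ)) (Pmat k p ^ k) r
      ≤ (k : ℝ) * (1 - p) := by
  have h := Pmat_pow_mulVec_rank_le hk hp k 0
  simpa [Matrix.mulVec, dotProduct, mul_comm] using h
end
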